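/- arXiv:2205.10890 — 2 statements merged into one kernel-verified Lean document; each statement's English description precedes it below -/
import Mathlib

section
/- Let k ≥ 2, π ∈ (0,1), let P = (p_1,…,p_k) be a categorical distribution on A = {1,…,k} with full support (all p_i > 0), and let P̂ and Q̂ be arbitrary categorical distributions on A. Set M̂ = πP̂ + (1−π)Q̂ and M̂_imp = πP̂ + (1−π)P. Then the exact representation D_JS(P̂, Q̂) = D_JS(P̂, P) + (1−π)·D_KL(Q̂, P) + D_KL(M̂_imp, P) − D_KL(M̂, P) holds. -/
open Finset

/-- Kullback–Leibler divergence between categorical distributions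
(with the convention `0 · ln 0 = 0`, which holds since `Real.log 0 = 0`). -/
noncomputable def KL {k : ℕ} (p q : Fin k → ℝ) : ℝ :=
  ∑ i, p i * Real.log (p i / q i)

/-- Jensen–Shannon divergence with weight `π`. -/
noncomputable def JS {k : ℕ} (π : ℝ) (p q : Fin k → ℝ) : ℝ :=
  π * KL p (fun i => π * p i + (1 - π) * q i)
    + (1 - π) * KL q (fun i => π * p i + (1 - π) * q i)

theorem KL_self {k : ℕ} {p : Fin k → ℝ} (hp : ∀ i, 0 < p i) : KL p p = 0 :=
  Finset.sum_eq_zero fun i _ => by simp [div_self (hp i).ne']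

theorem mul_log_div_eq_sub {x m c : ℝ} (hc : 0 < c) (h : x ≠ 0 → m ≠ 0) :
    x * Real.log (x / m) = x * Real.log (x / c) - x * Real.log (m / c) := by
  rcases eq_or_ne x 0 with rfl | hx
  · simp
  · rw [Real.log_div hx (h hx), Real.log_div hx hc.ne', Real.log_div (h hx) hc.ne']
    ring

/-- The divergence `KL p r` splits through any intermediate `m` whose support contains that
of `p`. -/
theorem KL_eq_sub_sum {k : ℕ} {p m r : Fin k → ℝ} (hr : ∀ i, 0 < r i)
    (h : ∀ i, p i ≠ 0 → m i ≠ 0) :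
    KL p m = KL p r - ∑ i, p i * Real.log (m i / r i) := by
  rw [KL, KL, ← Finset.sum_sub_distrib]
  exact Finset.sum_congr rfl fun i _ => mul_log_div_eq_sub (hr i) (h i)

/-- Compensation identity for the Jensen–Shannon divergence. -/
theorem JS_eq_sub_KL {k : ℕ} {π : ℝ} (hπ : π ∈ Set.Ioo (0 : ℝ) 1) {p q r : Fin k → ℝ}
    (hr : ∀ i, 0 < r i) (hp : ∀ i, 0 ≤ p i) (hq : ∀ i, 0 ≤ q i) :
    JS π p q = π * KL p r + (1 - π) * KL q r
      - KL (fun i => π * p i + (1 - π) * q i) r := by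
  have hπ₀ : 0 < π := hπ.1
  have hπ₁ : 0 < 1 - π := sub_pos.2 hπ.2
  have hpm : ∀ i, p i ≠ 0 → π * p i + (1 - π) * q i ≠ 0 := fun i hi =>
    (add_pos_of_pos_of_nonneg (mul_pos hπ₀ ((hp i).lt_of_ne' hi))
      (mul_nonneg hπ₁.le (hq i))).ne'
  have hqm : ∀ i, q i ≠ 0 → π * p i + (1 - π) * q i ≠ 0 := fun i hi =>
    (add_pos_of_nonneg_of_pos (mul_nonneg hπ₀.le (hp i))
      (mul_pos hπ₁ ((hq i).lt_of_ne' hi))).ne'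
  have hm : KL (fun i => π * p i + (1 - π) * q i) r
      = π * ∑ i, p i * Real.log ((π * p i + (1 - π) * q i) / r i)
        + (1 - π) * ∑ i, q i * Real.log ((π * p i + (1 - π) * q i) / r i) := by
    rw [KL, Finset.mul_sum, Finset.mul_sum, ← Finset.sum_add_distrib]
    exact Finset.sum_congr rfl fun i _ => by ring
  rw [JS, KL_eq_sub_sum hr hpm, KL_eq_sub_sum hr hqm, hm]
  ring

/-- exact representation of the simulator-based JSD statistic.
For `P` with full support and arbitrary categorical `P̂`, `Q̂`, with
`M̂_imp = πP̂ + (1−π)P` and `M̂ = πP̂ + (1−π)Q̂`: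
`D_JS(P̂,Q̂) = D_JS(P̂,P) + (1−π)·D_KL(Q̂,P) + D_KL(M̂_imp,P) − D_KL(M̂,P)`. -/
theorem jsd_exact_representation (k : ℕ) (hk : 2 ≤ k) (π : ℝ) (hπ : π ∈ Set.Ioo (0:ℝ) 1)
    (p phat qhat : Fin k → ℝ)
    (hp : ∀ i, 0 < p i) (hpsum : ∑ i, p i = 1)
    (hphat : ∀ i, 0 ≤ phat i) (hphatsum : ∑ i, phat i = 1)
    (hqhat : ∀ i, 0 ≤ qhat i) (hqhatsum : ∑ i, qhat i = 1) :
    JS π phat qhat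
      = JS π phat p + (1 - π) * KL qhat p
        + KL (fun i => π * phat i + (1 - π) * p i) p
        - KL (fun i => π * phat i + (1 - π) * qhat i) p := by
  rw [JS_eq_sub_KL hπ hp hphat hqhat, JS_eq_sub_KL hπ hp hphat fun i => (hp i).le, KL_self hp]
  ring
end

section
/- Let k ≥ 2, π ∈ (0,1), and let P and Q be categorical distributions on A = {1,…,k} whose total variation distance satisfies V(P,Q) < 1/2. Then D_JS(P,Q) ≤ −π(1−π)·ln(π(1−π))·V(P,Q) − 2π(1−π)·V(P,Q)·ln( V(P,Q)/k ). -/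
open Finset

/-- Total variation distance `V(P,Q) = ∑_i |p_i − q_i|`. -/
noncomputable def TV {k : ℕ} (p q : Fin k → ℝ) : ℝ :=
  ∑ i, |p i - q i|

/-- Chord bound for the logarithm on `[a, 1]`, in homogeneous form. -/
lemma mul_log_div_le {a b x y : ℝ} (ha : 0 < a) (hab : a + b = 1) (hy : 0 ≤ y) (hyx : y ≤ x) :
    x * Real.log (x / (a * x + b * y)) ≤ -Real.log a * (x - y) := by
  rcases eq_or_lt_of_le (hy.trans hyx) with rfl | hx
  · simp [le_antisymm hyx hy]
  have key := strictConcaveOn_log_Ioi.concaveOn.2 (Set.mem_Ioi.2 ha) (Set.mem_Ioi.2 one_pos)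
    (div_nonneg (sub_nonneg.2 hyx) hx.le) (div_nonneg hy hx.le) (by field_simp; ring)
  have hm : ((x - y) / x) • a + (y / x) • (1 : ℝ) = (x / (a * x + b * y))⁻¹ := by
    rw [← eq_sub_iff_add_eq'] at hab
    subst hab
    rw [inv_div, smul_eq_mul, smul_eq_mul]
    field_simp
    ring
  rw [hm, Real.log_inv, smul_eq_mul, smul_eq_mul, Real.log_one, mul_zero, add_zero] at key
  have hmul := mul_le_mul_of_nonneg_left key hx.le
  have heq : x * ((x - y) / x * Real.log a) = Real.log a * (x - y) := by field_simp
  linarith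

/-- Contribution of a single symbol to the Jensen–Shannon divergence. -/
lemma jensenShannon_term_le {a b x y : ℝ} (ha : 0 < a) (hb : 0 < b) (hab : a + b = 1)
    (hy : 0 ≤ y) (hyx : y ≤ x) :
    a * (x * Real.log (x / (a * x + b * y))) + b * (y * Real.log (y / (a * x + b * y)))
      ≤ -(a * Real.log a) * (x - y) := by
  have hym : y ≤ a * x + b * y := by
    rw [← eq_sub_iff_add_eq] at hab
    subst hab
    nlinarith
  have hlog : Real.log (y / (a * x + b * y)) ≤ 0 :=
    Real.log_nonpos (div_nonneg hy (hy.trans hym)) (div_le_one_of_le₀ hym (hy.trans hym))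
  have h₁ := mul_le_mul_of_nonneg_left (mul_log_div_le ha hab hy hyx) ha.le
  have h₂ := mul_nonpos_of_nonneg_of_nonpos hb.le (mul_nonpos_of_nonneg_of_nonpos hy hlog)
  linarith

/-- The Jensen–Shannon divergence is at most the binary entropy of the weight times half of the
total variation `∑ |p i - q i|`. -/
lemma JS_le_entropy_mul_TV {k : ℕ} {a b : ℝ} (ha : 0 < a) (hb : 0 < b) (hab : a + b = 1)
    {p q : Fin k → ℝ} (hp : ∀ i, 0 ≤ p i) (hq : ∀ i, 0 ≤ q i) (hpq : ∑ i, p i = ∑ i, q i) :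
    JS a p q ≤ -(a * Real.log a + b * Real.log b) / 2 * TV p q := by
  obtain rfl : b = 1 - a := by linarith
  have hterm (i : Fin k) :
      a * (p i * Real.log (p i / (a * p i + (1 - a) * q i)))
        + (1 - a) * (q i * Real.log (q i / (a * p i + (1 - a) * q i)))
      ≤ -(a * Real.log a + (1 - a) * Real.log (1 - a)) / 2 * |p i - q i|
        + ((1 - a) * Real.log (1 - a) - a * Real.log a) / 2 * (p i - q i) := by
    rcases le_total (q i) (p i) with h | h
    · have := jensenShannon_term_le ha hb hab (hq i) h
      rw [abs_of_nonneg (sub_nonneg.2 h)]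
      linarith
    · have := jensenShannon_term_le hb ha (by linarith) (hp i) h
      rw [abs_of_nonpos (sub_nonpos.2 h), add_comm (a * p i)]
      linarith
  have hsum := Finset.sum_le_sum fun i (_ : i ∈ Finset.univ) => hterm i
  simp only [Finset.sum_add_distrib, ← Finset.mul_sum, Finset.sum_sub_distrib, hpq, sub_self,
    mul_zero, add_zero] at hsum
  exact hsum

/-- Binary entropy bound for a weight `a` at most `1 / 2`. -/
lemma half_entropy_le_of_le {a b : ℝ} (ha : 0 < a) (hb : 0 < b) (hab : a + b = 1) (h : a ≤ b) :
    -(a * Real.log a + b * Real.log b) / 2 ≤ -(a * b) * Real.log (a * b) + 2 * (a * b) := by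
  rw [Real.log_mul ha.ne' hb.ne']
  have hla : Real.log a ≤ 0 := Real.log_nonpos ha.le (by linarith)
  have hlb : Real.log b ≤ 0 := Real.log_nonpos hb.le (by linarith)
  have h₁ : 0 ≤ (a * -Real.log a) * (b - 1 / 2) :=
    mul_nonneg (mul_nonneg ha.le (by linarith)) (by linarith)
  have h₂ : 0 ≤ a * b * -Real.log b := mul_nonneg (mul_pos ha hb).le (by linarith)
  have h₃ : b * (1 - b⁻¹) ≤ b * Real.log b :=
    mul_le_mul_of_nonneg_left (Real.one_sub_inv_le_log_of_pos hb) hb.le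
  have h₄ : b * (1 - b⁻¹) = -a := by
    rw [mul_sub, mul_inv_cancel₀ hb.ne']
    linarith
  have h₅ : 0 ≤ a * (b - 1 / 2) := mul_nonneg ha.le (by linarith)
  linarith

lemma half_entropy_le {a b : ℝ} (ha : 0 < a) (hb : 0 < b) (hab : a + b = 1) :
    -(a * Real.log a + b * Real.log b) / 2 ≤ -(a * b) * Real.log (a * b) + 2 * (a * b) := by
  rcases le_total a b with h | h
  · exact half_entropy_le_of_le ha hb hab h
  · rw [add_comm (a * Real.log a), mul_comm a b]
    exact half_entropy_le_of_le hb ha (by linarith) h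

/-- if `V(P,Q) < 1/2` then
`D_JS(P,Q) ≤ −π(1−π)·ln(π(1−π))·V(P,Q) − 2π(1−π)·V(P,Q)·ln(V(P,Q)/k)`
(with the convention `0·ln 0 = 0` in the boundary case `V(P,Q) = 0`,
which holds since `Real.log 0 = 0`). -/
theorem jsd_le_tv_bound (k : ℕ) (hk : 2 ≤ k) (π : ℝ) (hπ : π ∈ Set.Ioo (0:ℝ) 1)
    (p q : Fin k → ℝ)
    (hp : ∀ i, 0 ≤ p i) (hpsum : ∑ i, p i = 1)
    (hq : ∀ i, 0 ≤ q i) (hqsum : ∑ i, q i = 1)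
    (hV : TV p q < 1 / 2) :
    JS π p q
      ≤ -(π * (1 - π)) * Real.log (π * (1 - π)) * TV p q
        - 2 * (π * (1 - π)) * TV p q * Real.log (TV p q / k) := by
  obtain ⟨ha, hlt⟩ := hπ
  have hb : 0 < 1 - π := sub_pos.2 hlt
  have hJS := JS_le_entropy_mul_TV ha hb (by ring) hp hq (hpsum.trans hqsum.symm)
  have hV₀ : 0 ≤ TV p q := Finset.sum_nonneg fun i _ => abs_nonneg _
  rcases hV₀.eq_or_lt with h₀ | hpos
  · simpa [← h₀] using hJS
  have hk' : (2 : ℝ) ≤ k := by exact_mod_cast hk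
  have hlog : Real.log (TV p q / k) ≤ -1 := by
    have hquarter : TV p q / k ≤ 1 / 4 := by
      rw [div_le_iff₀ (by linarith)]
      linarith
    have hexp : (1 / 4 : ℝ) ≤ Real.exp (-1) := by
      rw [Real.exp_neg, one_div]
      exact inv_anti₀ (Real.exp_pos 1) (by linarith [Real.exp_one_lt_d9])
    exact (Real.log_le_iff_le_exp (div_pos hpos (by linarith))).2 (hquarter.trans hexp)
  have hent := mul_le_mul_of_nonneg_right (half_entropy_le ha hb (by ring)) hV₀
  have hmul := mul_le_mul_of_nonneg_left hlog
    (mul_nonneg (mul_nonneg zero_le_two (mul_pos ha hb).le) hV₀)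
  linarith
end
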